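/- Let f be an outer function in H² and let I, I₀ be inner functions with I(0) = I₀(0) = 0. If fK_I = fK_{I₀}(|f|²), then K_I = K_{I₀}; consequently I = I₀ up to a unimodular constant factor. -/

import Mathlib

open Complex MeasureTheory Filter Set

noncomputable section

/-! ### Basic framework: Hardy spaces on the unit disk via boundary values -/

/-- The open unit disk in the complex plane. -/
def unitDisk : Set ℂ := Metric.ball 0 1

/-- The point `e^{iθ}` of the unit circle. -/
def uc (θ : ℝ) : ℂ := Complex.exp ((θ : ℂ) * Complex.I)

/-- Lebesgue measure on the parameter interval `(0, 2π]` of the unit circle. -/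
def bMeasure : Measure ℝ := volume.restrict (Set.Ioc 0 (2 * Real.pi))

/-- Radial limit of `f` at the boundary point `w` (`|w| = 1`). -/
def radLim (f : ℂ → ℂ) (w : ℂ) : ℂ :=
  limUnder (nhdsWithin (1 : ℝ) (Set.Iio 1)) fun r : ℝ => f ((r : ℂ) * w)

/-- The boundary value function of `f` on the unit circle. -/
def bdry (f : ℂ → ℂ) (θ : ℝ) : ℂ := radLim f (uc θ)

/-- Membership in the Hardy space `H²` of the unit disk. -/
def MemH2 (f : ℂ → ℂ) : Prop :=
  DifferentiableOn ℂ f unitDisk ∧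
    ∃ C : ℝ, ∀ r ∈ Set.Ico (0 : ℝ) 1,
      (∫ θ in (0:ℝ)..(2 * Real.pi), ‖f ((r : ℂ) * uc θ)‖ ^ 2) ≤ C

/-- Membership in the Hardy space `H¹` of the unit disk. -/
def MemH1 (f : ℂ → ℂ) : Prop :=
  DifferentiableOn ℂ f unitDisk ∧
    ∃ C : ℝ, ∀ r ∈ Set.Ico (0 : ℝ) 1,
      (∫ θ in (0:ℝ)..(2 * Real.pi), ‖f ((r : ℂ) * uc θ)‖) ≤ C

/-- Membership in `H^∞` (bounded holomorphic functions on the disk). -/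
def MemHinf (f : ℂ → ℂ) : Prop :=
  DifferentiableOn ℂ f unitDisk ∧ ∃ C : ℝ, ∀ z ∈ unitDisk, ‖f z‖ ≤ C

/-- The `H²` (normalized boundary `L²`) inner product `⟨f, g⟩`. -/
def bInner (f g : ℂ → ℂ) : ℂ :=
  (1 / (2 * (Real.pi : ℂ))) *
    ∫ θ in (0:ℝ)..(2 * Real.pi), bdry f θ * (starRingEnd ℂ) (bdry g θ)

/-- The squared `H²` norm, computed on the boundary. -/
def bNormSq (f : ℂ → ℂ) : ℝ :=
  (1 / (2 * Real.pi)) * ∫ θ in (0:ℝ)..(2 * Real.pi), ‖bdry f θ‖ ^ 2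

/-- `f` is an inner function. -/
def IsInner (f : ℂ → ℂ) : Prop :=
  DifferentiableOn ℂ f unitDisk ∧ (∀ z ∈ unitDisk, ‖f z‖ ≤ 1) ∧
    ∀ᵐ θ ∂bMeasure, ‖bdry f θ‖ = 1

/-- `f` is an outer function: it is, up to a unimodular constant, the Herglotz
exponential of the Poisson integral of `log |f*|`. -/
def IsOuter (f : ℂ → ℂ) : Prop :=
  DifferentiableOn ℂ f unitDisk ∧ ∃ c : ℂ, ‖c‖ = 1 ∧ ∀ z ∈ unitDisk,
    f z = c * Complex.exp ((1 / (2 * (Real.pi : ℂ))) *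
      ∫ θ in (0:ℝ)..(2 * Real.pi),
        ((uc θ + z) / (uc θ - z)) * ((Real.log ‖bdry f θ‖ : ℝ) : ℂ))

/-- `b` is a nonextreme point of the closed unit ball of `H^∞`:
`log (1 - |b|)` is integrable on the circle. -/
def Nonextreme (b : ℂ → ℂ) : Prop :=
  DifferentiableOn ℂ b unitDisk ∧ (∀ z ∈ unitDisk, ‖b z‖ ≤ 1) ∧
    Integrable (fun θ => Real.log (1 - ‖bdry b θ‖)) bMeasure

/-- `(b, a)` is a pair: `b` nonextreme, `a` outer, `|a|² + |b|² = 1` a.e. on the circle. -/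
def IsPair (b a : ℂ → ℂ) : Prop :=
  Nonextreme b ∧ IsOuter a ∧
    ∀ᵐ θ ∂bMeasure, ‖bdry a θ‖ ^ 2 + ‖bdry b θ‖ ^ 2 = 1

/-- `(b, a)` is the pair associated with the outer function `f` of unit `H²` norm:
`f = a / (1 - b)`. -/
def PairAssoc (f b a : ℂ → ℂ) : Prop :=
  IsOuter f ∧ MemH2 f ∧ bNormSq f = 1 ∧ IsPair b a ∧
    ∀ z ∈ unitDisk, f z = a z / (1 - b z)

/-- The Herglotz measure `μ_λ` of `(1 + λ̄b)/(1 − λ̄b)` is absolutely continuous: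
the Herglotz representation holds with density `|a/(1 − λ̄b)|²` and no singular part. -/
def HerglotzAC (b a : ℂ → ℂ) (lam : ℂ) : Prop :=
  ∀ z ∈ unitDisk,
    (1 + (starRingEnd ℂ) lam * b z) / (1 - (starRingEnd ℂ) lam * b z) =
      (1 / (2 * (Real.pi : ℂ))) *
        (∫ θ in (0:ℝ)..(2 * Real.pi),
          ((1 + (uc θ)⁻¹ * z) / (1 - (uc θ)⁻¹ * z)) *
            ((‖bdry (fun w => a w / (1 - (starRingEnd ℂ) lam * b w)) θ‖ ^ 2 : ℝ) : ℂ)) +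
      Complex.I *
        ((((1 + (starRingEnd ℂ) lam * b 0) / (1 - (starRingEnd ℂ) lam * b 0)).im : ℝ) : ℂ)

/-- The pair `(b, a)` is special: the Herglotz measure of `(1+b)/(1−b)` is
absolutely continuous. -/
def SpecialPair (b a : ℂ → ℂ) : Prop := IsPair b a ∧ HerglotzAC b a 1

/-- `F ∈ H¹` is rigid: the only functions of `H¹` with the same argument a.e. on the
circle are the positive scalar multiples of `F`. -/
def Rigid (F : ℂ → ℂ) : Prop :=
  MemH1 F ∧ ∀ G : ℂ → ℂ, MemH1 G →
    (∀ᵐ θ ∂bMeasure, ∃ t : ℝ, 0 < t ∧ bdry G θ = (t : ℂ) * bdry F θ) →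
    ∃ c : ℝ, 0 < c ∧ ∀ z ∈ unitDisk, G z = (c : ℂ) * F z

/-- The Riesz (analytic) projection `P₊` of a boundary function, realized through the
Szegő integral: `(P₊u)(z) = (1/2π) ∫ u(θ) (1 − z e^{-iθ})⁻¹ dθ`. -/
def szProj (u : ℝ → ℂ) : ℂ → ℂ := fun z =>
  (1 / (2 * (Real.pi : ℂ))) *
    ∫ θ in (0:ℝ)..(2 * Real.pi), u θ * (1 - z * (uc θ)⁻¹)⁻¹

/-- The Toeplitz operator with boundary symbol `φ`: `T_φ h = P₊(φ · h*)`. -/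
def toeplitz (φ : ℝ → ℂ) (h : ℂ → ℂ) : ℂ → ℂ := szProj fun θ => φ θ * bdry h θ

/-- The kernel of the Toeplitz operator `T_φ`, as a subset of `H²`. -/
def toeplitzKer (φ : ℝ → ℂ) : Set (ℂ → ℂ) :=
  {h | MemH2 h ∧ ∀ z ∈ unitDisk, toeplitz φ h z = 0}

/-- The boundary symbol `ḡ` of a function `g` on the disk. -/
def conjBdry (g : ℂ → ℂ) : ℝ → ℂ := fun θ => (starRingEnd ℂ) (bdry g θ)

/-- The boundary symbol `ḡ/g`. -/
def symbQuot (g : ℂ → ℂ) : ℝ → ℂ := fun θ => (starRingEnd ℂ) (bdry g θ) / bdry g θ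

/-- The boundary symbol `Ī f̄ / f`. -/
def symbIf (I f : ℂ → ℂ) : ℝ → ℂ :=
  fun θ => (starRingEnd ℂ) (bdry I θ) * (starRingEnd ℂ) (bdry f θ) / bdry f θ

/-- The model space `K_I = H² ⊖ I H² = ker T_Ī` of an inner function `I`. -/
def modelSpace (I : ℂ → ℂ) : Set (ℂ → ℂ) := toeplitzKer (conjBdry I)

/-- The set `f·K_I`. -/
def fModel (f I : ℂ → ℂ) : Set (ℂ → ℂ) :=
  {g | ∃ h ∈ modelSpace I, ∀ z ∈ unitDisk, g z = f z * h z}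

/-- The orthogonal complement `ker T_{Ī f̄/f} ⊖ f·K_I` of `f·K_I` in the kernel of
`T_{Ī f̄/f}`, with respect to the `H²` inner product. -/
def kerPerp (I f : ℂ → ℂ) : Set (ℂ → ℂ) :=
  {h | h ∈ toeplitzKer (symbIf I f) ∧ ∀ g ∈ fModel f I, bInner h g = 0}

/-- `M(a) = T_a H² = a·H²` (for `a ∈ H^∞`), the range of `T_a`, as a set. -/
def rangeMa (a : ℂ → ℂ) : Set (ℂ → ℂ) :=
  {g | ∃ h, MemH2 h ∧ ∀ z ∈ unitDisk, g z = a z * h z}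

/-- Membership in the de Branges–Rovnyak space `H(b)` for nonextreme `b` with
pair `(b, a)`:  `h ∈ H(b)` iff `h ∈ H²` and `T_b̄ h = T_ā h⁺` for some `h⁺ ∈ H²`
(Sarason's characterization). -/
def MemHb (b a h : ℂ → ℂ) : Prop :=
  MemH2 h ∧ ∃ h' : ℂ → ℂ, MemH2 h' ∧
    ∀ z ∈ unitDisk, toeplitz (conjBdry b) h z = toeplitz (conjBdry a) h' z

/-- The function `h⁺ ∈ H²` with `T_b̄ h = T_ā h⁺` (unique when it exists, since `a`
is outer). -/
def plusFun (b a h : ℂ → ℂ) : ℂ → ℂ :=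
  Classical.epsilon fun h' : ℂ → ℂ => MemH2 h' ∧
    ∀ z ∈ unitDisk, toeplitz (conjBdry b) h z = toeplitz (conjBdry a) h' z

/-- The inner product of `H(b)`: `⟨h, g⟩_b = ⟨h, g⟩₂ + ⟨h⁺, g⁺⟩₂`. -/
def hbInner (b a h g : ℂ → ℂ) : ℂ :=
  bInner h g + bInner (plusFun b a h) (plusFun b a g)

/-- The squared norm of `H(b)`. -/
def hbNormSq (b a h : ℂ → ℂ) : ℝ := (hbInner b a h h).re

/-- The closure of a set `S` in the norm of `H(b)`. -/
def hbClosure (b a : ℂ → ℂ) (S : Set (ℂ → ℂ)) : Set (ℂ → ℂ) :=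
  {h | MemHb b a h ∧ ∀ ε : ℝ, 0 < ε → ∃ g ∈ S,
    hbNormSq b a (fun z => h z - g z) < ε}

/-- The orthogonal complement of `S` in `H(b)`. -/
def hbPerp (b a : ℂ → ℂ) (S : Set (ℂ → ℂ)) : Set (ℂ → ℂ) :=
  {h | MemHb b a h ∧ ∀ g ∈ S, hbInner b a h g = 0}

/-- A set of functions on the disk is a `k`-dimensional linear subspace. -/
def HasDimOn (S : Set (ℂ → ℂ)) (k : ℕ) : Prop :=
  ∃ g : Fin k → (ℂ → ℂ), (∀ j, g j ∈ S) ∧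
    (∀ c : Fin k → ℂ, (∀ z ∈ unitDisk, (∑ j, c j * g j z) = 0) → c = 0) ∧
    ∀ h ∈ S, ∃ c : Fin k → ℂ, ∀ z ∈ unitDisk, h z = ∑ j, c j * g j z

/-- The Szegő kernel `k_w(z) = (1 - w̄ z)⁻¹` of `H²`. -/
def szKernel (w z : ℂ) : ℂ := (1 - (starRingEnd ℂ) w * z)⁻¹

/-- The reproducing kernel of `H(b)` at an interior point `w ∈ 𝔻`. -/
def hbKernel (b : ℂ → ℂ) (w z : ℂ) : ℂ :=
  (1 - (starRingEnd ℂ) (b w) * b z) / (1 - (starRingEnd ℂ) w * z)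

/-- The boundary kernel of `H(b)` at a boundary point `z₀`, defined through the
nontangential limit `b(z₀) = radLim b z₀`. -/
def hbBoundaryKernel (b : ℂ → ℂ) (z₀ z : ℂ) : ℂ :=
  (1 - (starRingEnd ℂ) (radLim b z₀) * b z) / (1 - (starRingEnd ℂ) z₀ * z)

/-- `u` is a nontangential approach sequence to the boundary point `z₀`. -/
def NTApproach (u : ℕ → ℂ) (z₀ : ℂ) : Prop :=
  (∀ n, u n ∈ unitDisk) ∧ Filter.Tendsto u Filter.atTop (nhds z₀) ∧
    ∃ M : ℝ, ∀ n, ‖u n - z₀‖ ≤ M * (1 - ‖u n‖)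

/-- `b` has an angular derivative in the sense of Carathéodory at `z₀ ∈ ∂𝔻`. -/
def HasADC (b : ℂ → ℂ) (z₀ : ℂ) : Prop :=
  ‖radLim b z₀‖ = 1 ∧ ∃ L : ℂ, ∀ u : ℕ → ℂ, NTApproach u z₀ →
    Filter.Tendsto (fun n => b (u n)) Filter.atTop (nhds (radLim b z₀)) ∧
    Filter.Tendsto (fun n => (b (u n) - radLim b z₀) / (u n - z₀)) Filter.atTop (nhds L)


/-- The Smirnov class `N⁺`: quotients of `H^∞` functions with outer denominator. -/
def MemSmirnov (g : ℂ → ℂ) : Prop :=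
  ∃ u v : ℂ → ℂ, MemHinf u ∧ MemHinf v ∧ IsOuter v ∧ ∀ z ∈ unitDisk, g z = u z / v z

/-- The weighted Hardy space `H²(|f|²)`. -/
def MemWeightedH2 (f g : ℂ → ℂ) : Prop :=
  MemSmirnov g ∧ Integrable (fun θ => ‖bdry g θ‖ ^ 2 * ‖bdry f θ‖ ^ 2) bMeasure

/-- The subspace `H₀²(|f|²) = z·H²(|f|²)`. -/
def MemWeightedH02 (f ψ : ℂ → ℂ) : Prop :=
  ∃ q : ℂ → ℂ, MemWeightedH2 f q ∧ ∀ z ∈ unitDisk, ψ z = z * q z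

/-- The backward-shift invariant subspace `K_I(|f|²)` of `H²(|f|²)`:
functions `g = I ψ̄` (a.e. on `∂𝔻`) with `ψ ∈ H₀²(|f|²)`. -/
def weightedModel (f I : ℂ → ℂ) : Set (ℂ → ℂ) :=
  {g : ℂ → ℂ | MemWeightedH2 f g ∧ ∃ ψ : ℂ → ℂ, MemWeightedH02 f ψ ∧
    ∀ᵐ θ ∂bMeasure, bdry g θ = bdry I θ * (starRingEnd ℂ) (bdry ψ θ)}

/-! ### Radial limits of bounded holomorphic functions -/

theorem norm_uc (θ : ℝ) : ‖uc θ‖ = 1 := Complex.norm_exp_ofReal_mul_I θ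

theorem uc_ne_zero (θ : ℝ) : uc θ ≠ 0 := Complex.exp_ne_zero _

theorem conj_uc (θ : ℝ) : (starRingEnd ℂ) (uc θ) = (uc θ)⁻¹ :=
  (Complex.inv_eq_conj (norm_uc θ)).symm

theorem mem_unitDisk {z : ℂ} : z ∈ unitDisk ↔ ‖z‖ < 1 := mem_ball_zero_iff

theorem mul_uc_mem_unitDisk {r : ℝ} (h0 : 0 ≤ r) (h1 : r < 1) (θ : ℝ) :
    (r : ℂ) * uc θ ∈ unitDisk := by
  rw [mem_unitDisk, norm_mul, norm_uc, mul_one, Complex.norm_real, Real.norm_of_nonneg h0]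
  exact h1

theorem continuous_uc : Continuous uc := by
  unfold uc; fun_prop

theorem hasDerivAt_uc (θ : ℝ) : HasDerivAt uc (uc θ * Complex.I) θ := by
  have h : HasDerivAt (fun t : ℝ => (t : ℂ) * Complex.I) (1 * Complex.I) θ :=
    (Complex.ofRealCLM.hasDerivAt (x := θ)).mul_const _
  simpa [uc] using! h.cexp

/-- A maximum principle of Lindelöf type: tangential smallness near a boundary point `ζ` of a
function vanishing linearly at `ζ` propagates into the disk, up to an exponential peak function. -/
theorem exists_norm_mul_peak_le {R : ℂ → ℂ} (hR : DiffContOnCl ℂ R (Metric.ball 0 1)) {ζ : ℂ}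
    (hζ : ‖ζ‖ = 1) {M : ℝ} (hM : ∀ w ∈ Metric.closedBall (0 : ℂ) 1, ‖R w‖ ≤ M * ‖w - ζ‖)
    {ε δ : ℝ} (hε : 0 < ε) (hδ : 0 < δ)
    (hsmall : ∀ w : ℂ, ‖w‖ = 1 → ‖w - ζ‖ < δ → ‖R w‖ ≤ ε * ‖w - ζ‖) :
    ∃ N : ℝ, ∀ w ∈ Metric.ball (0 : ℂ) 1,
      ‖R w * Complex.exp (-(N * (1 - w * (starRingEnd ℂ) ζ)))‖ ≤ ε * ‖w - ζ‖ := by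
  have hM0 : 0 ≤ M := by
    have := (norm_nonneg _).trans (hM (-ζ) (by simp [hζ]))
    have h2 : ‖-ζ - ζ‖ = 2 := by
      rw [show -ζ - ζ = (-2 : ℂ) * ζ by ring, norm_mul, hζ]; simp
    rw [h2] at this; linarith
  have hre : ∀ w : ℂ, ‖w‖ ≤ 1 → 0 ≤ (1 - w * (starRingEnd ℂ) ζ).re := by
    intro w hw
    have h1 : (w * (starRingEnd ℂ) ζ).re ≤ ‖w * (starRingEnd ℂ) ζ‖ := Complex.re_le_norm _
    rw [norm_mul, RCLike.norm_conj, hζ, mul_one] at h1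
    simp only [Complex.sub_re, Complex.one_re]; linarith
  have hre' : ∀ w : ℂ, ‖w‖ = 1 → (1 - w * (starRingEnd ℂ) ζ).re = ‖w - ζ‖ ^ 2 / 2 := by
    intro w hw
    have h1 : w.re * w.re + w.im * w.im = 1 := by
      have := Complex.sq_norm w; rw [hw, Complex.normSq_apply] at this; linarith
    have h2 : ζ.re * ζ.re + ζ.im * ζ.im = 1 := by
      have := Complex.sq_norm ζ; rw [hζ, Complex.normSq_apply] at this; linarith
    rw [Complex.sq_norm, Complex.normSq_apply]
    simp only [Complex.sub_re, Complex.one_re, Complex.mul_re, Complex.conj_re, Complex.conj_im,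
      Complex.sub_im]
    nlinarith
  obtain ⟨N, hN0, hN⟩ : ∃ N : ℝ, 0 ≤ N ∧ M * Real.exp (-(N * (δ ^ 2 / 2))) ≤ ε := by
    have h : Tendsto (fun N : ℝ => M * Real.exp (-(N * (δ ^ 2 / 2)))) atTop (nhds (M * 0)) :=
      (Real.tendsto_exp_neg_atTop_nhds_zero.comp
        (tendsto_id.atTop_mul_const (by positivity))).const_mul _
    rw [mul_zero] at h
    obtain ⟨N, h1, h2⟩ := ((eventually_ge_atTop (0 : ℝ)).and (h.eventually (gt_mem_nhds hε))).exists
    exact ⟨N, h1, h2.le⟩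
  refine ⟨N, ?_⟩
  set B : ℂ → ℂ := fun w => Complex.exp (-(N * (1 - w * (starRingEnd ℂ) ζ))) with hB
  have hBn : ∀ w, ‖B w‖ = Real.exp (-(N * (1 - w * (starRingEnd ℂ) ζ).re)) := by
    intro w
    simp [hB, Complex.norm_exp]
  have hB1 : ∀ w : ℂ, ‖w‖ ≤ 1 → ‖B w‖ ≤ 1 := by
    intro w hw
    rw [hBn, Real.exp_le_one_iff]
    have := mul_nonneg hN0 (hre w hw)
    linarith
  have hBd : Differentiable ℂ B := by fun_prop
  have hRBM : ∀ w ∈ Metric.closedBall (0 : ℂ) 1, ‖R w * B w‖ ≤ M * ‖w - ζ‖ := by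
    intro w hw
    rw [norm_mul]
    calc ‖R w‖ * ‖B w‖ ≤ (M * ‖w - ζ‖) * 1 :=
          mul_le_mul (hM w hw) (hB1 w (by simpa using hw)) (norm_nonneg _) (by positivity)
      _ = _ := mul_one _
  have hRBε : ∀ w : ℂ, ‖w‖ = 1 → ‖R w * B w‖ ≤ ε * ‖w - ζ‖ := by
    intro w hw
    rcases lt_or_ge ‖w - ζ‖ δ with h | h
    · rw [norm_mul]
      calc ‖R w‖ * ‖B w‖ ≤ (ε * ‖w - ζ‖) * 1 :=
            mul_le_mul (hsmall w hw h) (hB1 w hw.le) (norm_nonneg _) (by positivity)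
        _ = _ := mul_one _
    · rw [norm_mul]
      have h1 : ‖B w‖ ≤ Real.exp (-(N * (δ ^ 2 / 2))) := by
        rw [hBn, hre' w hw]
        gcongr
      calc ‖R w‖ * ‖B w‖ ≤ (M * ‖w - ζ‖) * Real.exp (-(N * (δ ^ 2 / 2))) :=
            mul_le_mul (hM w (by simp [hw])) h1 (norm_nonneg _) (by positivity)
        _ = (M * Real.exp (-(N * (δ ^ 2 / 2)))) * ‖w - ζ‖ := by ring
        _ ≤ _ := by gcongr
  have hRBζ : R ζ * B ζ = 0 := by
    have := hRBM ζ (by simp [hζ])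
    rw [sub_self, norm_zero, mul_zero] at this
    exact norm_le_zero_iff.1 this
  -- take `n`-th roots to remove the constant
  have key : ∀ n : ℕ, ∀ w ∈ Metric.ball (0 : ℂ) 1,
      ‖(R w * B w) ^ (n + 1) / (w - ζ) ^ n‖ ≤ 2 * ε ^ (n + 1) := by
    intro n w hw
    have hcl : closure (Metric.ball (0 : ℂ) 1) = Metric.closedBall 0 1 :=
      closure_ball _ one_ne_zero
    have hbound : ∀ c : ℝ, 0 ≤ c → ∀ z, ‖R z * B z‖ ≤ c * ‖z - ζ‖ →
        ‖(R z * B z) ^ (n + 1) / (z - ζ) ^ n‖ ≤ c ^ (n + 1) * ‖z - ζ‖ := by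
      intro c hc z hz
      rcases eq_or_ne z ζ with rfl | hne
      · simp [hRBζ]
      have hp : 0 < ‖z - ζ‖ := norm_pos_iff.2 (sub_ne_zero.2 hne)
      rw [norm_div, norm_pow, norm_pow, div_le_iff₀ (by positivity)]
      calc ‖R z * B z‖ ^ (n + 1) ≤ (c * ‖z - ζ‖) ^ (n + 1) := by gcongr
        _ = _ := by ring
    refine Complex.norm_le_of_forall_mem_frontier_norm_le (U := Metric.ball (0 : ℂ) 1)
      (f := fun w => (R w * B w) ^ (n + 1) / (w - ζ) ^ n) Metric.isBounded_ball ⟨?_, ?_⟩ ?_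
      (subset_closure hw)
    · intro z hz
      have hne : z - ζ ≠ 0 := by
        intro h
        rw [sub_eq_zero] at h
        simp [h, hζ] at hz
      have h1 := hR.differentiableOn z hz
      have h2 := hBd.differentiableAt.differentiableWithinAt (s := Metric.ball (0 : ℂ) 1) (x := z)
      exact ((h1.mul h2).pow _).div (by fun_prop) (pow_ne_zero _ hne)
    · rw [hcl]
      intro z hz
      rcases eq_or_ne z ζ with rfl | hne
      · have h0 : (R z * B z) ^ (n + 1) / (z - z) ^ n = 0 := by simp [hRBζ]
        simp only [ContinuousWithinAt, h0]
        refine squeeze_zero_norm' (a := fun x => M ^ (n + 1) * ‖x - z‖) ?_ ?_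
        · filter_upwards [self_mem_nhdsWithin] with x hx
          exact hbound M hM0 x (hRBM x hx)
        · have : ContinuousWithinAt (fun x : ℂ => M ^ (n + 1) * ‖x - z‖)
              (Metric.closedBall 0 1) z := by fun_prop
          simpa [ContinuousWithinAt] using this
      · have h1 : ContinuousWithinAt R (Metric.closedBall 0 1) z := by
          have := hR.continuousOn; rw [hcl] at this; exact this z hz
        exact ((h1.mul hBd.continuous.continuousWithinAt).pow _).div (by fun_prop)
          (pow_ne_zero _ (sub_ne_zero.2 hne))
    · intro z hz
      rw [frontier_ball _ one_ne_zero, mem_sphere_zero_iff_norm] at hz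
      refine (hbound ε hε.le z (hRBε z hz)).trans ?_
      have : ‖z - ζ‖ ≤ 2 := (norm_sub_le _ _).trans (by rw [hz, hζ]; norm_num)
      calc ε ^ (n + 1) * ‖z - ζ‖ ≤ ε ^ (n + 1) * 2 := by gcongr
        _ = _ := mul_comm _ _
  intro w hw
  have hne : w - ζ ≠ 0 := by
    intro h
    rw [sub_eq_zero] at h
    simp [h, hζ] at hw
  have hp : 0 < ‖w - ζ‖ := norm_pos_iff.2 hne
  by_contra! hlt
  have hx : 1 < ‖R w * B w‖ / (ε * ‖w - ζ‖) := (one_lt_div (by positivity)).2 hlt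
  obtain ⟨n, hn⟩ := pow_unbounded_of_one_lt (2 / ‖w - ζ‖) hx
  have h1 := key n w hw
  have h2 : (‖R w * B w‖ / (ε * ‖w - ζ‖)) ^ (n + 1) ≤ 2 / ‖w - ζ‖ := by
    rw [norm_div, norm_pow, norm_pow, div_le_iff₀ (by positivity)] at h1
    rw [div_pow, div_le_div_iff₀ (by positivity) hp]
    calc ‖R w * B w‖ ^ (n + 1) * ‖w - ζ‖ ≤ (2 * ε ^ (n + 1) * ‖w - ζ‖ ^ n) * ‖w - ζ‖ := by gcongr
      _ = _ := by ring
  have h3 : (‖R w * B w‖ / (ε * ‖w - ζ‖)) ^ n ≤ (‖R w * B w‖ / (ε * ‖w - ζ‖)) ^ (n + 1) :=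
    pow_le_pow_right₀ hx.le (Nat.le_succ n)
  linarith

/-- If the boundary trace of a Lipschitz primitive is differentiable at `θ`, then the derivative
has a radial limit there. -/
theorem exists_tendsto_radial_of_primitive {Φ g : ℂ → ℂ} {K : NNReal} (hK : LipschitzWith K Φ)
    (hΦ : ∀ z ∈ unitDisk, HasDerivAt Φ (g z) z) {θ : ℝ}
    (hθ : DifferentiableAt ℝ (fun t => Φ (uc t)) θ) :
    ∃ L, Tendsto (fun r : ℝ => g (r * uc θ)) (nhdsWithin 1 (Iio 1)) (nhds L) := by
  set ζ := uc θ with hζdef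
  have hζ : ‖ζ‖ = 1 := norm_uc θ
  have hζ0 : ζ ≠ 0 := uc_ne_zero θ
  set d := deriv (fun t => Φ (uc t)) θ with hd
  set D : ℂ := d / (ζ * Complex.I) with hD
  set R : ℂ → ℂ := fun w => Φ w - Φ ζ - D * (w - ζ) with hR
  have hRd : ∀ z ∈ unitDisk, HasDerivAt R (g z - D) z := by
    intro z hz
    have h := ((hΦ z hz).sub_const (Φ ζ)).sub (((hasDerivAt_id z).sub_const ζ).const_mul D)
    simpa using! h
  have hRcont : Continuous R := by
    have := hK.continuous
    fun_prop
  have hRdc : DiffContOnCl ℂ R (Metric.ball 0 1) :=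
    ⟨fun z hz => (hRd z hz).differentiableAt.differentiableWithinAt, hRcont.continuousOn⟩
  have hM : ∀ w : ℂ, ‖R w‖ ≤ (K + ‖D‖) * ‖w - ζ‖ := by
    intro w
    calc ‖R w‖ ≤ ‖Φ w - Φ ζ‖ + ‖D * (w - ζ)‖ := norm_sub_le _ _
      _ ≤ K * ‖w - ζ‖ + ‖D‖ * ‖w - ζ‖ := by
        rw [norm_mul]; gcongr; exact hK.norm_sub_le w ζ
      _ = _ := by ring
  have htan : HasDerivAt (fun t => R (uc t)) 0 θ := by
    have h := (hθ.hasDerivAt.sub_const (Φ ζ)).sub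
      (((hasDerivAt_uc θ).sub_const ζ).const_mul D)
    have h0 : d - D * (uc θ * Complex.I) = 0 := by
      rw [hD, ← hζdef, div_mul_cancel₀ _ (mul_ne_zero hζ0 Complex.I_ne_zero), sub_self]
    rw [← hd, h0] at h
    exact h
  refine ⟨D, ?_⟩
  rw [Metric.tendsto_nhds]
  intro ε₀ hε₀
  set ε := ε₀ / 12 with hεdef
  have hε : 0 < ε := by positivity
  -- tangential smallness
  obtain ⟨δ, hδ, hsmall⟩ : ∃ δ > 0, ∀ w : ℂ, ‖w‖ = 1 → ‖w - ζ‖ < δ →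
      ‖R w‖ ≤ ε * ‖w - ζ‖ := by
    have hRζ : R (uc θ) = 0 := by simp [hR, ← hζdef]
    have h1 := (hasDerivAt_iff_isLittleO.1 htan).def (c := ε / 2) (by positivity)
    simp only [hRζ, smul_zero, sub_zero] at h1
    obtain ⟨δ, hδ, h2⟩ := Metric.eventually_nhds_iff.1 h1
    refine ⟨δ / 2, by positivity, fun w hw hwδ => ?_⟩
    have ha : |(w / ζ).arg| ≤ 2 * ‖w - ζ‖ := by
      rw [← Complex.angle_eq_abs_arg (by rintro rfl; simp at hw) hζ0]
      refine (Complex.angle_le_mul_norm_sub hw hζ).trans ?_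
      gcongr
      linarith [Real.pi_le_four]
    have hw' : uc (θ + (w / ζ).arg) = w := by
      have hn : ‖w / ζ‖ = 1 := by rw [norm_div, hw, hζ, div_one]
      have h3 := Complex.norm_mul_exp_arg_mul_I (w / ζ)
      rw [hn, Complex.ofReal_one, one_mul] at h3
      have h4 : uc (θ + (w / ζ).arg) = uc θ * Complex.exp ((w / ζ).arg * Complex.I) := by
        simp only [uc]
        rw [← Complex.exp_add]; congr 1; push_cast; ring
      rw [h4, h3, ← hζdef, mul_div_cancel₀ _ hζ0]
    have h5 := @h2 (θ + (w / ζ).arg) (by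
      rw [Real.dist_eq, add_sub_cancel_left]; linarith)
    rw [hw', add_sub_cancel_left, Real.norm_eq_abs] at h5
    calc ‖R w‖ ≤ ε / 2 * |(w / ζ).arg| := h5
      _ ≤ ε / 2 * (2 * ‖w - ζ‖) := by gcongr
      _ = _ := by ring
  obtain ⟨N, hN⟩ := exists_norm_mul_peak_le hRdc hζ (fun w _ => hM w) hε hδ hsmall
  obtain ⟨η, hη, hpeak⟩ : ∃ η > 0, ∀ w : ℂ, ‖w - ζ‖ < η →
      1 / 2 < ‖Complex.exp (-(N * (1 - w * (starRingEnd ℂ) ζ)))‖ := by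
    have hc : Continuous fun w : ℂ => ‖Complex.exp (-(N * (1 - w * (starRingEnd ℂ) ζ)))‖ := by
      fun_prop
    have h1 : ζ * (starRingEnd ℂ) ζ = 1 := by rw [hζdef, conj_uc, mul_inv_cancel₀ (uc_ne_zero θ)]
    have h := hc.continuousAt (x := ζ) |>.eventually (lt_mem_nhds (a := 1 / 2) (by
      simp only [h1]; norm_num))
    obtain ⟨η, hη, h2⟩ := Metric.eventually_nhds_iff.1 h
    exact ⟨η, hη, fun w hw => h2 (by rwa [dist_eq_norm])⟩
  have hRsmall : ∀ w ∈ unitDisk, ‖w - ζ‖ < η → ‖R w‖ ≤ 2 * ε * ‖w - ζ‖ := by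
    intro w hw hwη
    have h1 := hN w hw
    have h2 := hpeak w hwη
    rw [norm_mul] at h1
    have h3 : ‖R w‖ * (1 / 2) ≤ ε * ‖w - ζ‖ :=
      (mul_le_mul_of_nonneg_left h2.le (norm_nonneg _)).trans h1
    linarith
  have hev : ∀ᶠ r in nhdsWithin (1 : ℝ) (Iio 1), r ∈ Ioo (max 0 (1 - η / 2)) 1 :=
    Ioo_mem_nhdsLT (max_lt one_pos (by linarith))
  filter_upwards [hev] with r hr
  have hr0 : 0 < r := (le_max_left _ _).trans_lt hr.1
  have hrη : 1 - η / 2 < r := (le_max_right _ _).trans_lt hr.1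
  have hr1 : r < 1 := hr.2
  have hz : (r : ℂ) * ζ ∈ unitDisk := mul_uc_mem_unitDisk hr0.le hr1 θ
  have hzn : ‖(r : ℂ) * ζ‖ = r := by
    rw [norm_mul, hζ, mul_one, Complex.norm_real, Real.norm_of_nonneg hr0.le]
  have hzζ : ‖(r : ℂ) * ζ - ζ‖ = 1 - r := by
    rw [show (r : ℂ) * ζ - ζ = ((r - 1 : ℝ) : ℂ) * ζ by push_cast; ring, norm_mul, hζ, mul_one,
      Complex.norm_real, Real.norm_eq_abs, abs_sub_comm, abs_of_pos (by linarith)]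
  set ρ := (1 - r) / 2 with hρ
  have hρ0 : 0 < ρ := by rw [hρ]; linarith
  have hd2 : ‖deriv R (r * ζ)‖ ≤ 2 * ε * (3 / 2 * (1 - r)) / ρ := by
    refine Complex.norm_deriv_le_of_forall_mem_sphere_norm_le hρ0 ?_ ?_
    · refine hRdc.mono ?_
      refine Metric.ball_subset_ball' ?_
      rw [dist_zero_right, hzn]; linarith
    · intro w hw
      rw [mem_sphere_iff_norm] at hw
      have h1 : ‖w‖ < 1 := by
        have := norm_le_norm_add_norm_sub' w ((r : ℂ) * ζ)
        linarith
      have h2 : ‖w - ζ‖ ≤ 3 / 2 * (1 - r) := by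
        have := norm_sub_le_norm_sub_add_norm_sub w ((r : ℂ) * ζ) ζ
        linarith
      refine (hRsmall w (mem_unitDisk.2 h1) (by linarith)).trans ?_
      gcongr
  rw [(hRd _ hz).deriv] at hd2
  rw [dist_eq_norm]
  calc ‖g (r * ζ) - D‖ ≤ _ := hd2
    _ = 6 * ε := by
      have : 1 - r ≠ 0 := by linarith
      rw [hρ]; field_simp; ring
    _ < ε₀ := by rw [hεdef]; linarith

/-- **Fatou's theorem** for `H^∞`. -/
theorem ae_tendsto_bdry {g : ℂ → ℂ} (hg : MemHinf g) :
    ∀ᵐ θ ∂(volume : Measure ℝ),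
      Tendsto (fun r : ℝ => g (r * uc θ)) (nhdsWithin 1 (Iio 1)) (nhds (bdry g θ)) := by
  obtain ⟨hd, C, hC⟩ := hg
  obtain ⟨Φ₀, hΦ₀⟩ := hd.isExactOn_ball
  have hlip : LipschitzOnWith C.toNNReal Φ₀ unitDisk := by
    refine (convex_ball (0 : ℂ) 1).lipschitzOnWith_of_nnnorm_hasDerivWithin_le (𝕜 := ℂ) (f' := g)
      (fun z hz => (hΦ₀ z hz).hasDerivWithinAt) (fun z hz => ?_)
    exact NNReal.coe_le_coe.1 (by simpa using Or.inl (hC z hz))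
  obtain ⟨Φ, hΦ, heq⟩ := hlip.extend_finite_dimension
  have hder : ∀ z ∈ unitDisk, HasDerivAt Φ (g z) z := by
    intro z hz
    refine (hΦ₀ z hz).congr_of_eventuallyEq ?_
    filter_upwards [Metric.isOpen_ball.mem_nhds hz] with w hw
    exact (heq hw).symm
  have huc : LipschitzWith 1 uc := by
    refine lipschitzWith_of_nnnorm_deriv_le (fun t => (hasDerivAt_uc t).differentiableAt) ?_
    intro t
    rw [(hasDerivAt_uc t).deriv]
    exact NNReal.coe_le_coe.1 (by simp [norm_uc])
  filter_upwards [(hΦ.comp huc).ae_differentiableAt_real] with θ hθ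
  exact tendsto_nhds_limUnder (exists_tendsto_radial_of_primitive hΦ hder hθ)

/-! ### Boundary values and integrals over the circle -/

instance : IsFiniteMeasure bMeasure := by
  unfold bMeasure; infer_instance

theorem intervalIntegral_eq_bMeasure {E : Type*} [NormedAddCommGroup E] [NormedSpace ℝ E]
    (F : ℝ → E) : ∫ θ in (0:ℝ)..(2 * Real.pi), F θ = ∫ θ, F θ ∂bMeasure :=
  intervalIntegral.integral_of_le (by positivity)

theorem bMeasure_real_univ : bMeasure.real univ = 2 * Real.pi := by
  simp [bMeasure, Real.pi_pos.le]

theorem ae_bMeasure_of_ae {p : ℝ → Prop} (h : ∀ᵐ θ ∂(volume : Measure ℝ), p θ) :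
    ∀ᵐ θ ∂bMeasure, p θ := ae_restrict_of_ae h

theorem bdry_eq_of_tendsto {g : ℂ → ℂ} {θ : ℝ} {L : ℂ}
    (h : Tendsto (fun r : ℝ => g (r * uc θ)) (nhdsWithin 1 (Iio 1)) (nhds L)) :
    bdry g θ = L := h.limUnder_eq

theorem eventually_mul_uc_mem_unitDisk :
    ∀ᶠ r : ℝ in nhdsWithin 1 (Iio 1), ∀ θ, (r : ℂ) * uc θ ∈ unitDisk := by
  filter_upwards [Ioo_mem_nhdsLT (zero_lt_one' ℝ)] with r hr θ
  exact mul_uc_mem_unitDisk hr.1.le hr.2 θ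

theorem bdry_congr {g k : ℂ → ℂ} (h : ∀ z ∈ unitDisk, g z = k z) : bdry g = bdry k := by
  funext θ
  have : (fun r : ℝ => g (r * uc θ)) =ᶠ[nhdsWithin 1 (Iio 1)] fun r : ℝ => k (r * uc θ) := by
    filter_upwards [eventually_mul_uc_mem_unitDisk] with r hr
    exact h _ (hr θ)
  simp only [bdry, radLim, limUnder, Filter.map_congr this]

theorem tendsto_mul_uc (θ : ℝ) :
    Tendsto (fun r : ℝ => (r : ℂ) * uc θ) (nhdsWithin 1 (Iio 1)) (nhds (uc θ)) := by
  have : Continuous fun r : ℝ => (r : ℂ) * uc θ := by fun_prop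
  simpa using (this.tendsto 1).mono_left nhdsWithin_le_nhds

theorem tendsto_radial_of_continuousAt {k : ℂ → ℂ} {θ : ℝ} (h : ContinuousAt k (uc θ)) :
    Tendsto (fun r : ℝ => k (r * uc θ)) (nhdsWithin 1 (Iio 1)) (nhds (k (uc θ))) :=
  h.tendsto.comp (tendsto_mul_uc θ)

theorem MemHinf.mul {g k : ℂ → ℂ} (hg : MemHinf g) (hk : MemHinf k) :
    MemHinf fun z => g z * k z := by
  obtain ⟨hgd, C, hC⟩ := hg
  obtain ⟨hkd, D, hD⟩ := hk
  refine ⟨hgd.mul hkd, C * D, fun z hz => ?_⟩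
  rw [norm_mul]
  exact mul_le_mul (hC z hz) (hD z hz) (norm_nonneg _) ((norm_nonneg _).trans (hC z hz))

theorem memHinf_const (c : ℂ) : MemHinf fun _ => c :=
  ⟨differentiableOn_const c, ‖c‖, fun _ _ => le_rfl⟩

theorem memHinf_id : MemHinf fun z => z :=
  ⟨differentiableOn_id, 1, fun _ hz => (mem_unitDisk.1 hz).le⟩

theorem IsInner.memHinf {g : ℂ → ℂ} (hg : IsInner g) : MemHinf g := ⟨hg.1, 1, hg.2.1⟩

theorem one_sub_mul_ne_zero {w z : ℂ} (hw : ‖w‖ < 1) (hz : ‖z‖ ≤ 1) : 1 - w * z ≠ 0 := by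
  intro h
  have h1 : ‖w * z‖ = 1 := by rw [← sub_eq_zero.1 h, norm_one]
  rw [norm_mul] at h1
  nlinarith [norm_nonneg w, norm_nonneg z]

theorem memHinf_cauchyKernel {w : ℂ} (hw : ‖w‖ < 1) : MemHinf fun z => (1 - w * z)⁻¹ := by
  refine ⟨fun z hz => ?_, (1 - ‖w‖)⁻¹, fun z hz => ?_⟩
  · have h : DifferentiableAt ℂ (fun z => 1 - w * z) z := by fun_prop
    exact (h.inv (one_sub_mul_ne_zero hw (mem_unitDisk.1 hz).le)).differentiableWithinAt
  · rw [norm_inv]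
    refine inv_anti₀ (by linarith) ?_
    have h1 : ‖w * z‖ ≤ ‖w‖ := by
      rw [norm_mul]
      exact mul_le_of_le_one_right (norm_nonneg _) (mem_unitDisk.1 hz).le
    have := norm_sub_norm_le (1 : ℂ) (w * z)
    rw [norm_one] at this
    linarith

theorem bdry_cauchyKernel {w : ℂ} (hw : ‖w‖ < 1) (θ : ℝ) :
    bdry (fun z => (1 - w * z)⁻¹) θ = (1 - w * uc θ)⁻¹ := by
  refine bdry_eq_of_tendsto
    (tendsto_radial_of_continuousAt (k := fun z => (1 - w * z)⁻¹) ?_)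
  have h : ContinuousAt (fun z => 1 - w * z) (uc θ) := by fun_prop
  exact h.inv₀ (one_sub_mul_ne_zero hw (norm_uc θ).le)

theorem bdry_mul {g k : ℂ → ℂ} (hg : MemHinf g) (hk : MemHinf k) :
    ∀ᵐ θ ∂bMeasure, bdry (fun z => g z * k z) θ = bdry g θ * bdry k θ := by
  filter_upwards [ae_bMeasure_of_ae (ae_tendsto_bdry hg), ae_bMeasure_of_ae (ae_tendsto_bdry hk)]
    with θ h1 h2
  exact bdry_eq_of_tendsto (h1.mul h2)

theorem bdry_const_mul {g : ℂ → ℂ} (hg : MemHinf g) (c : ℂ) :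
    ∀ᵐ θ ∂bMeasure, bdry (fun z => c * g z) θ = c * bdry g θ := by
  filter_upwards [ae_bMeasure_of_ae (ae_tendsto_bdry hg)] with θ h1
  exact bdry_eq_of_tendsto (h1.const_mul c)

theorem bdry_const (c : ℂ) (θ : ℝ) : bdry (fun _ => c) θ = c :=
  bdry_eq_of_tendsto tendsto_const_nhds

theorem norm_bdry_le {g : ℂ → ℂ} (hg : MemHinf g) {C : ℝ} (hC : ∀ z ∈ unitDisk, ‖g z‖ ≤ C) :
    ∀ᵐ θ ∂bMeasure, ‖bdry g θ‖ ≤ C := by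
  filter_upwards [ae_bMeasure_of_ae (ae_tendsto_bdry hg)] with θ h1
  refine le_of_tendsto h1.norm ?_
  filter_upwards [eventually_mul_uc_mem_unitDisk] with r hr
  exact hC _ (hr θ)

theorem continuous_comp_mul_uc {g : ℂ → ℂ} (hg : DifferentiableOn ℂ g unitDisk) {r : ℝ}
    (hr : ∀ θ, (r : ℂ) * uc θ ∈ unitDisk) : Continuous fun θ : ℝ => g (r * uc θ) :=
  hg.continuousOn.comp_continuous (continuous_const.mul continuous_uc) hr

theorem aestronglyMeasurable_bdry {g : ℂ → ℂ} (hg : MemHinf g) :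
    AEStronglyMeasurable (bdry g) bMeasure := by
  have hs : Tendsto (fun n : ℕ => 1 - 1 / ((n : ℝ) + 1)) atTop (nhdsWithin 1 (Iio 1)) := by
    refine tendsto_nhdsWithin_iff.2 ⟨?_, Eventually.of_forall fun n => ?_⟩
    · simpa using tendsto_one_div_add_atTop_nhds_zero_nat.const_sub (1 : ℝ)
    · simp only [mem_Iio, sub_lt_self_iff]; positivity
  refine aestronglyMeasurable_of_tendsto_ae (u := (atTop : Filter ℕ))
    (f := fun n θ => g (((1 - 1 / ((n : ℝ) + 1) : ℝ) : ℂ) * uc θ)) (fun n => ?_) ?_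
  · refine (continuous_comp_mul_uc hg.1 fun θ => mul_uc_mem_unitDisk ?_ ?_ θ).aestronglyMeasurable
    · rw [sub_nonneg, div_le_one (by positivity)]
      linarith [n.cast_nonneg (α := ℝ)]
    · rw [sub_lt_self_iff]; positivity
  · filter_upwards [ae_bMeasure_of_ae (ae_tendsto_bdry hg)] with θ h
    exact h.comp hs

theorem integrable_bdry {g : ℂ → ℂ} (hg : MemHinf g) : Integrable (bdry g) bMeasure := by
  obtain ⟨C, hC⟩ := hg.2
  exact Integrable.of_bound (aestronglyMeasurable_bdry hg) C (norm_bdry_le hg hC)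

theorem circleMap_eq_mul_uc (r θ : ℝ) : circleMap 0 r θ = r * uc θ := by
  simp [circleMap, uc]

/-- Cauchy's integral formula over boundary values. -/
theorem integral_cauchy_bdry {g : ℂ → ℂ} (hg : MemHinf g) {z : ℂ} (hz : z ∈ unitDisk) :
    ∫ θ, uc θ / (uc θ - z) * bdry g θ ∂bMeasure = 2 * Real.pi * g z := by
  obtain ⟨C, hC⟩ := hg.2
  have hz1 : ‖z‖ < 1 := mem_unitDisk.1 hz
  set s := (1 + ‖z‖) / 2 with hs
  have hs1 : s < 1 := by rw [hs]; linarith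
  have hev : ∀ᶠ r : ℝ in nhdsWithin 1 (Iio 1), r ∈ Ioo s 1 := Ioo_mem_nhdsLT hs1
  have hdist : ∀ r ∈ Ioo s 1, ∀ θ, (1 - ‖z‖) / 2 ≤ ‖(r : ℂ) * uc θ - z‖ := by
    intro r hr θ
    have h1 := norm_sub_norm_le ((r : ℂ) * uc θ) z
    have h2 : r ≤ |r| := le_abs_self r
    rw [norm_mul, norm_uc, mul_one, Complex.norm_real, Real.norm_eq_abs] at h1
    have := hr.1
    rw [hs] at this
    linarith
  have hpos : 0 < (1 - ‖z‖) / 2 := by linarith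
  have hr0 : ∀ r ∈ Ioo s 1, 0 < r := fun r hr =>
    lt_trans (by rw [hs]; positivity) hr.1
  have hlim : Tendsto (fun r : ℝ => ∫ θ, (r * uc θ) / (r * uc θ - z) * g (r * uc θ) ∂bMeasure)
      (nhdsWithin 1 (Iio 1)) (nhds (∫ θ, uc θ / (uc θ - z) * bdry g θ ∂bMeasure)) := by
    refine tendsto_integral_filter_of_dominated_convergence
      (fun _ => 1 / ((1 - ‖z‖) / 2) * C) ?_ ?_ (integrable_const _) ?_
    · filter_upwards [hev] with r hr
      refine Continuous.aestronglyMeasurable ?_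
      refine Continuous.mul (Continuous.div (continuous_const.mul continuous_uc)
        ((continuous_const.mul continuous_uc).sub continuous_const) fun θ h => ?_)
        (continuous_comp_mul_uc hg.1 (mul_uc_mem_unitDisk (hr0 r hr).le hr.2))
      have := hdist r hr θ
      rw [h, norm_zero] at this
      linarith
    · filter_upwards [hev] with r hr
      refine Eventually.of_forall fun θ => ?_
      rw [norm_mul, norm_div]
      have hm := mul_uc_mem_unitDisk (hr0 r hr).le hr.2 θ
      gcongr
      · exact (mem_unitDisk.1 hm).le
      · exact hdist r hr θ
      · exact hC _ hm
    · filter_upwards [ae_bMeasure_of_ae (ae_tendsto_bdry hg)] with θ h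
      have hne : uc θ - z ≠ 0 := by
        intro h0
        rw [← sub_eq_zero.1 h0, norm_uc] at hz1
        exact lt_irrefl _ hz1
      exact ((tendsto_mul_uc θ).div ((tendsto_mul_uc θ).sub_const z) hne).mul h
  refine tendsto_nhds_unique (hlim.congr' ?_) tendsto_const_nhds |>.symm ▸ rfl
  filter_upwards [hev] with r hr
  have hd : DiffContOnCl ℂ g (Metric.ball 0 |r|) := by
    rw [abs_of_pos (hr0 r hr)]
    refine (hg.1.mono ?_).diffContOnCl_ball subset_rfl
    exact Metric.closedBall_subset_ball hr.2
  have h := hd.circleAverage_smul_div (w := z) (by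
    rw [mem_ball_zero_iff, abs_of_pos (hr0 r hr)]
    have := hr.1
    rw [hs] at this
    linarith)
  rw [Real.circleAverage_def, intervalIntegral_eq_bMeasure] at h
  simp only [circleMap_eq_mul_uc, sub_zero, smul_eq_mul] at h
  rw [← h, Complex.real_smul]
  have : (Real.pi : ℂ) ≠ 0 := by exact_mod_cast Real.pi_ne_zero
  push_cast
  field_simp

theorem integral_bdry {g : ℂ → ℂ} (hg : MemHinf g) :
    ∫ θ, bdry g θ ∂bMeasure = 2 * Real.pi * g 0 := by
  rw [← integral_cauchy_bdry hg (by simp [unitDisk])]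
  simp [div_self (uc_ne_zero _)]

/-- A bounded holomorphic function is determined by its boundary values. -/
theorem eq_of_bdry_ae_eq {g k : ℂ → ℂ} (hg : MemHinf g) (hk : MemHinf k)
    (h : ∀ᵐ θ ∂bMeasure, bdry g θ = bdry k θ) {z : ℂ} (hz : z ∈ unitDisk) : g z = k z := by
  have h1 : ∫ θ, uc θ / (uc θ - z) * bdry g θ ∂bMeasure =
      ∫ θ, uc θ / (uc θ - z) * bdry k θ ∂bMeasure := by
    refine integral_congr_ae ?_
    filter_upwards [h] with θ hθ
    rw [hθ]
  rw [integral_cauchy_bdry hg hz, integral_cauchy_bdry hk hz] at h1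
  exact mul_left_cancel₀ (by simp [Real.pi_ne_zero]) h1

/-- Jensen's inequality for the boundary values of a bounded holomorphic function. -/
theorem log_norm_le_integral_log_bdry_add {g : ℂ → ℂ} (hg : MemHinf g) (h0 : g 0 ≠ 0) {ε : ℝ}
    (hε : 0 < ε) :
    2 * Real.pi * Real.log ‖g 0‖ ≤ ∫ θ, Real.log (‖bdry g θ‖ + ε) ∂bMeasure := by
  obtain ⟨C, hC⟩ := hg.2
  have hev : ∀ᶠ r : ℝ in nhdsWithin 1 (Iio 1), r ∈ Ioo 0 1 := Ioo_mem_nhdsLT one_pos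
  have hcont : Continuous fun w : ℂ => Real.log (‖w‖ + ε) :=
    Continuous.log (by fun_prop) fun w => by positivity
  have hbd : ∀ w : ℂ, ‖w‖ ≤ C → ‖Real.log (‖w‖ + ε)‖ ≤ |Real.log ε| + |Real.log (C + ε)| := by
    intro w hw
    rw [Real.norm_eq_abs, abs_le]
    have h1 : Real.log ε ≤ Real.log (‖w‖ + ε) :=
      Real.log_le_log hε (by linarith [norm_nonneg w])
    have h2 : Real.log (‖w‖ + ε) ≤ Real.log (C + ε) :=
      Real.log_le_log (by positivity) (by linarith)
    constructor
    · linarith [neg_abs_le (Real.log ε), abs_nonneg (Real.log (C + ε))]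
    · linarith [le_abs_self (Real.log (C + ε)), abs_nonneg (Real.log ε)]
  have hlim : Tendsto (fun r : ℝ => ∫ θ, Real.log (‖g (r * uc θ)‖ + ε) ∂bMeasure)
      (nhdsWithin 1 (Iio 1)) (nhds (∫ θ, Real.log (‖bdry g θ‖ + ε) ∂bMeasure)) := by
    refine tendsto_integral_filter_of_dominated_convergence
      (fun _ => |Real.log ε| + |Real.log (C + ε)|) ?_ ?_ (integrable_const _) ?_
    · filter_upwards [hev] with r hr
      exact (hcont.comp (continuous_comp_mul_uc hg.1
        (mul_uc_mem_unitDisk hr.1.le hr.2))).aestronglyMeasurable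
    · filter_upwards [hev] with r hr
      exact Eventually.of_forall fun θ => hbd _ (hC _ (mul_uc_mem_unitDisk hr.1.le hr.2 θ))
    · filter_upwards [ae_bMeasure_of_ae (ae_tendsto_bdry hg)] with θ h
      exact (hcont.tendsto _).comp h
  refine ge_of_tendsto hlim ?_
  filter_upwards [hev] with r hr
  have hr0 : r ≠ 0 := hr.1.ne'
  have habs : |r| = r := abs_of_pos hr.1
  have han : AnalyticOnNhd ℂ g (Metric.closedBall 0 |r|) := by
    rw [habs]
    exact (hg.1.analyticOnNhd Metric.isOpen_ball).mono (Metric.closedBall_subset_ball hr.2)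
  have hne : ∀ᵐ θ ∂bMeasure, g (circleMap 0 r θ) ≠ 0 := by
    have h1 : g ⁻¹' {0}ᶜ ∈ codiscreteWithin (Metric.closedBall (0 : ℂ) |r|) :=
      han.preimage_zero_mem_codiscreteWithin h0 (by simp)
        ((convex_closedBall _ _).isConnected (Metric.nonempty_closedBall.2 (abs_nonneg r)))
    have h2 := codiscreteWithin_mono Metric.sphere_subset_closedBall h1
    have h3 := codiscreteWithin_mono (subset_univ (Ioc 0 (2 * Real.pi)))
      (circleMap_preimage_codiscrete hr0 h2)
    exact ae_restrict_le_codiscreteWithin measurableSet_Ioc h3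
  have hint : Integrable (fun θ => Real.log ‖g (circleMap 0 r θ)‖) bMeasure := by
    have := (han.mono Metric.sphere_subset_closedBall).meromorphicOn.circleIntegrable_log_norm
    rw [CircleIntegrable, intervalIntegrable_iff_integrableOn_Ioc_of_le (by positivity)] at this
    exact this
  have hge : Real.log ‖g 0‖ ≤ Real.circleAverage (Real.log ‖g ·‖) 0 r := by
    rw [han.circleAverage_log_norm hr0 h0]
    refine le_add_of_nonneg_left (finsum_nonneg fun u => ?_)
    by_cases hu : u ∈ Metric.closedBall (0 : ℂ) |r|
    · refine mul_nonneg (by exact_mod_cast MeromorphicOn.AnalyticOnNhd.divisor_nonneg han u) ?_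
      rw [zero_sub, norm_neg]
      rcases eq_or_ne u 0 with rfl | hu0
      · simp
      · refine Real.log_nonneg ?_
        rw [← div_eq_mul_inv, one_le_div (norm_pos_iff.2 hu0), ← habs]
        simpa using hu
    · rw [Function.locallyFinsuppWithin.apply_eq_zero_of_notMem _ hu]
      simp
  rw [Real.circleAverage_def, intervalIntegral_eq_bMeasure, smul_eq_mul,
    inv_mul_eq_div, le_div_iff₀ (by positivity), mul_comm] at hge
  refine hge.trans (integral_mono_ae hint ?_ ?_)
  · refine Integrable.of_bound (hcont.comp (continuous_comp_mul_uc hg.1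
      (mul_uc_mem_unitDisk hr.1.le hr.2))).aestronglyMeasurable _ (Eventually.of_forall fun θ =>
        hbd _ (hC _ (mul_uc_mem_unitDisk hr.1.le hr.2 θ)))
  · filter_upwards [hne] with θ hθ
    rw [circleMap_eq_mul_uc] at hθ ⊢
    exact Real.log_le_log (norm_pos_iff.2 hθ) (by linarith)

/-! ### Membership in model spaces -/

theorem MemHinf.memH2 {g : ℂ → ℂ} (hg : MemHinf g) : MemH2 g := by
  obtain ⟨hd, C, hC⟩ := hg
  refine ⟨hd, C ^ 2 * |2 * Real.pi - 0|, fun r hr => ?_⟩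
  refine (Real.le_norm_self _).trans (intervalIntegral.norm_integral_le_of_norm_le_const fun θ _ => ?_)
  rw [norm_pow, norm_norm]
  exact pow_le_pow_left₀ (norm_nonneg _) (hC _ (mul_uc_mem_unitDisk hr.1 hr.2 θ)) 2

theorem modelSpace_congr {I h k : ℂ → ℂ} (hhk : ∀ z ∈ unitDisk, h z = k z)
    (hh : h ∈ modelSpace I) : k ∈ modelSpace I := by
  obtain ⟨⟨hd, C, hC⟩, hT⟩ := hh
  refine ⟨⟨hd.congr fun z hz => (hhk z hz).symm, C, fun r hr => ?_⟩, fun z hz => ?_⟩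
  · simpa only [hhk _ (mul_uc_mem_unitDisk hr.1 hr.2 _)] using hC r hr
  · rw [← hT z hz]
    simp only [toeplitz, bdry_congr hhk]

theorem weightedModel_congr {f I h k : ℂ → ℂ} (hhk : ∀ z ∈ unitDisk, h z = k z)
    (hh : h ∈ weightedModel f I) : k ∈ weightedModel f I := by
  obtain ⟨⟨⟨u, v, hu, hv, hvo, huv⟩, hint⟩, hψ⟩ := hh
  rw [bdry_congr hhk] at hint hψ
  exact ⟨⟨⟨u, v, hu, hv, hvo, fun z hz => (hhk z hz).symm.trans (huv z hz)⟩, hint⟩, hψ⟩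

theorem IsOuter.ne_zero {f : ℂ → ℂ} (hf : IsOuter f) {z : ℂ} (hz : z ∈ unitDisk) : f z ≠ 0 := by
  obtain ⟨-, c, hc, h⟩ := hf
  rw [h z hz]
  exact mul_ne_zero (norm_pos_iff.1 (hc ▸ one_pos)) (Complex.exp_ne_zero _)

theorem isOuter_one : IsOuter fun _ => 1 :=
  ⟨differentiableOn_const 1, 1, norm_one, fun z _ => by simp [bdry_const]⟩

theorem MemHinf.memSmirnov {g : ℂ → ℂ} (hg : MemHinf g) : MemSmirnov g :=
  ⟨g, fun _ => 1, hg, memHinf_const 1, isOuter_one, fun z _ => by simp⟩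

theorem modelSpace_eq_weightedModel {f I I₀ : ℂ → ℂ} (hf : IsOuter f)
    (heq : fModel f I =
      {g : ℂ → ℂ | ∃ h ∈ weightedModel f I₀, ∀ z ∈ unitDisk, g z = f z * h z}) :
    modelSpace I = weightedModel f I₀ := by
  ext h
  constructor
  · intro hh
    have h1 : (fun z => f z * h z) ∈ fModel f I := ⟨h, hh, fun _ _ => rfl⟩
    rw [heq] at h1
    obtain ⟨k, hk, hfk⟩ := h1
    exact weightedModel_congr (fun z hz => (mul_left_cancel₀ (hf.ne_zero hz) (hfk z hz)).symm) hk
  · intro hh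
    have h1 : (fun z => f z * h z) ∈
        {g : ℂ → ℂ | ∃ h ∈ weightedModel f I₀, ∀ z ∈ unitDisk, g z = f z * h z} :=
      ⟨h, hh, fun _ _ => rfl⟩
    rw [← heq] at h1
    obtain ⟨k, hk, hfk⟩ := h1
    exact modelSpace_congr (fun z hz => (mul_left_cancel₀ (hf.ne_zero hz) (hfk z hz)).symm) hk

/-- The Riesz projection annihilates the conjugates of bounded functions vanishing at `0`. -/
theorem szProj_eq_zero {g : ℂ → ℂ} (hg : MemHinf g) (h0 : g 0 = 0) {φ : ℝ → ℂ}
    (hφ : ∀ᵐ θ ∂bMeasure, φ θ = (starRingEnd ℂ) (bdry g θ)) {z : ℂ} (hz : z ∈ unitDisk) :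
    szProj φ z = 0 := by
  have hz' : ‖(starRingEnd ℂ) z‖ < 1 := by
    rw [RCLike.norm_conj]; exact mem_unitDisk.1 hz
  have hk := memHinf_cauchyKernel hz'
  have h1 : ∫ θ, φ θ * (1 - z * (uc θ)⁻¹)⁻¹ ∂bMeasure =
      ∫ θ, (starRingEnd ℂ) (bdry (fun ζ => g ζ * (1 - (starRingEnd ℂ) z * ζ)⁻¹) θ) ∂bMeasure := by
    refine integral_congr_ae ?_
    filter_upwards [hφ, bdry_mul hg hk] with θ h2 h3
    rw [h2, h3, bdry_cauchyKernel hz', map_mul, map_inv₀, map_sub, map_mul, conj_uc]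
    simp
  rw [szProj, intervalIntegral_eq_bMeasure, h1, integral_conj, integral_bdry (hg.mul hk), h0]
  simp

theorem one_mem_modelSpace {I : ℂ → ℂ} (hI : MemHinf I) (h0 : I 0 = 0) :
    (fun _ => 1) ∈ modelSpace I :=
  ⟨(memHinf_const 1).memH2, fun _ hz =>
    szProj_eq_zero hI h0 (ae_of_all _ fun θ => by simp [conjBdry, bdry_const]) hz⟩

theorem bdry_id (θ : ℝ) : bdry (fun z => z) θ = uc θ :=
  bdry_eq_of_tendsto (tendsto_mul_uc θ)

/-- Schwarz's lemma: dividing out a zero at the origin. -/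
theorem IsInner.exists_eq_mul {I : ℂ → ℂ} (hI : IsInner I) (h0 : I 0 = 0) :
    ∃ J, MemHinf J ∧ ∀ᵐ θ ∂bMeasure, bdry J θ = bdry I θ * (uc θ)⁻¹ := by
  have hJ : MemHinf (dslope I 0) := by
    refine ⟨(differentiableOn_dslope (Metric.ball_mem_nhds 0 one_pos)).2 hI.1, 1 / 1,
      fun z hz => ?_⟩
    refine Complex.norm_dslope_le_div_of_mapsTo_ball hI.1 (fun w hw => ?_) hz
    rw [h0, mem_closedBall_zero_iff]
    exact hI.2.1 w hw
  refine ⟨dslope I 0, hJ, ?_⟩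
  filter_upwards [bdry_mul memHinf_id hJ] with θ h
  have h1 : (fun z => z * dslope I 0 z) = I := by
    funext z
    simpa [h0] using sub_smul_dslope I 0 z
  rw [h1, bdry_id] at h
  rw [h]
  field_simp [uc_ne_zero θ]

theorem IsInner.mem_modelSpace {I J : ℂ → ℂ} (hI : IsInner I) (hJ : MemHinf J)
    (hIJ : ∀ᵐ θ ∂bMeasure, bdry J θ = bdry I θ * (uc θ)⁻¹) : J ∈ modelSpace I := by
  refine ⟨hJ.memH2, fun z hz => szProj_eq_zero memHinf_id rfl ?_ hz⟩
  filter_upwards [hIJ, hI.2.2] with θ h1 h2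
  rw [conjBdry, h1, bdry_id, conj_uc, ← mul_assoc, ← Complex.normSq_eq_conj_mul_self,
    Complex.normSq_eq_norm_sq, h2]
  simp

theorem IsInner.mem_weightedModel {f I J : ℂ → ℂ} (hI : IsInner I) (hJ : MemHinf J)
    (hIJ : ∀ᵐ θ ∂bMeasure, bdry J θ = bdry I θ * (uc θ)⁻¹)
    (h1 : MemWeightedH2 f fun _ => 1) : J ∈ weightedModel f I := by
  refine ⟨⟨hJ.memSmirnov, h1.2.congr ?_⟩, fun z => z * 1, ⟨_, h1, fun _ _ => rfl⟩, ?_⟩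
  · filter_upwards [hIJ, hI.2.2] with θ h2 h3
    rw [h2, norm_mul, h3, norm_inv, norm_uc, bdry_const]
    simp
  · filter_upwards [hIJ] with θ h2
    simp only [mul_one]
    rw [h2, bdry_id, conj_uc]

/-! ### Logarithmic integrability and rigidity of unimodular multipliers -/

/-- **Szegő's theorem** for `H^∞`: boundary values are log-integrable, with Jensen's inequality. -/
theorem integrable_log_norm_bdry {g : ℂ → ℂ} (hg : MemHinf g) (h0 : g 0 ≠ 0) :
    (∀ᵐ θ ∂bMeasure, bdry g θ ≠ 0) ∧ Integrable (fun θ => Real.log ‖bdry g θ‖) bMeasure ∧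
      2 * Real.pi * Real.log ‖g 0‖ ≤ ∫ θ, Real.log ‖bdry g θ‖ ∂bMeasure := by
  obtain ⟨C, hC⟩ := hg.2
  set M := Real.log (C + 1)
  set K := 2 * Real.pi * M - 2 * Real.pi * Real.log ‖g 0‖
  set ε : ℕ → ℝ := fun n => 1 / ((n : ℝ) + 1)
  have hε : ∀ n, 0 < ε n := fun n => by positivity
  have hε1 : ∀ n, ε n ≤ 1 := fun n => by
    rw [div_le_one (by positivity)]
    linarith [n.cast_nonneg (α := ℝ)]
  have hεlim : Tendsto ε atTop (nhds 0) := tendsto_one_div_add_atTop_nhds_zero_nat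
  have hmeas := aestronglyMeasurable_bdry hg
  have hlogm : AEMeasurable (fun θ => Real.log ‖bdry g θ‖) bMeasure :=
    Real.measurable_log.comp_aemeasurable hmeas.norm.aemeasurable
  have hbd := norm_bdry_le hg hC
  have hnonneg : ∀ n, ∀ᵐ θ ∂bMeasure, 0 ≤ M - Real.log (‖bdry g θ‖ + ε n) := fun n => by
    filter_upwards [hbd] with θ h
    exact sub_nonneg.2 (Real.log_le_log (by linarith [hε n, norm_nonneg (bdry g θ)])
      (add_le_add h (hε1 n)))
  have hint : ∀ n, Integrable (fun θ => Real.log (‖bdry g θ‖ + ε n)) bMeasure := fun n => by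
    refine Integrable.of_bound (Real.measurable_log.comp_aemeasurable
      (hmeas.norm.aemeasurable.add_const _)).aestronglyMeasurable (|Real.log (ε n)| + |M|) ?_
    filter_upwards [hnonneg n] with θ h
    have h1 : Real.log (ε n) ≤ Real.log (‖bdry g θ‖ + ε n) :=
      Real.log_le_log (hε n) (by linarith [norm_nonneg (bdry g θ)])
    rw [Real.norm_eq_abs, abs_le]
    constructor
    · linarith [neg_abs_le (Real.log (ε n)), abs_nonneg M]
    · linarith [le_abs_self M, abs_nonneg (Real.log (ε n))]
  have hle : ∀ n, ∫ θ, (M - Real.log (‖bdry g θ‖ + ε n)) ∂bMeasure ≤ K := fun n => by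
    rw [integral_sub (integrable_const _) (hint n), integral_const, bMeasure_real_univ, smul_eq_mul]
    linarith [log_norm_le_integral_log_bdry_add hg h0 (hε n)]
  have hK : 0 ≤ K := (integral_nonneg_of_ae (hnonneg 0)).trans (hle 0)
  set F : ℕ → ℝ → ENNReal := fun n θ => ENNReal.ofReal (M - Real.log (‖bdry g θ‖ + ε n))
  have hFm : ∀ n, AEMeasurable (F n) bMeasure := fun n =>
    ((hint n).aestronglyMeasurable.aemeasurable.const_sub M).ennreal_ofReal
  have hfatou : ∫⁻ θ, liminf (fun n => F n θ) atTop ∂bMeasure ≤ ENNReal.ofReal K := by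
    refine (lintegral_liminf_le' hFm).trans ?_
    refine (liminf_le_liminf (Eventually.of_forall fun n => ?_)).trans_eq
      (liminf_const (f := (atTop : Filter ℕ)) (ENNReal.ofReal K))
    have hi : Integrable (fun θ => M - Real.log (‖bdry g θ‖ + ε n)) bMeasure :=
      (integrable_const _).sub (hint n)
    exact (ofReal_integral_eq_lintegral_ofReal hi (hnonneg n)).symm.trans_le
      (ENNReal.ofReal_le_ofReal (hle n))
  have hlm : AEMeasurable (fun θ => liminf (fun n => F n θ) atTop) bMeasure :=
    (Measurable.liminf (f := fun n (x : ℝ) => ENNReal.ofReal (M - Real.log (x + ε n)))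
      fun n => by fun_prop).comp_aemeasurable hmeas.norm.aemeasurable
  have hne : ∀ᵐ θ ∂bMeasure, bdry g θ ≠ 0 := by
    filter_upwards [ae_lt_top' hlm (hfatou.trans_lt ENNReal.ofReal_lt_top).ne]
      with θ h hz
    refine h.ne (Tendsto.liminf_eq ?_)
    refine ENNReal.tendsto_ofReal_nhds_top.2 ?_
    rw [hz, norm_zero]
    simp only [zero_add]
    have h1 : Tendsto (fun n => Real.log (ε n)) atTop atBot :=
      Real.tendsto_log_nhdsGT_zero.comp (tendsto_nhdsWithin_iff.2 ⟨hεlim, Eventually.of_forall hε⟩)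
    simpa [sub_eq_add_neg] using tendsto_atTop_add_const_left _ M (tendsto_neg_atBot_atTop.comp h1)
  have hlim : ∀ᵐ θ ∂bMeasure, liminf (fun n => F n θ) atTop =
      ENNReal.ofReal (M - Real.log ‖bdry g θ‖) := by
    filter_upwards [hne] with θ h
    refine Tendsto.liminf_eq (ENNReal.tendsto_ofReal (Tendsto.const_sub M ?_))
    have h1 := (Real.continuousAt_log (norm_ne_zero_iff.2 h)).tendsto
    refine Tendsto.comp h1 ?_
    simpa using hεlim.const_add ‖bdry g θ‖
  rw [lintegral_congr_ae hlim] at hfatou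
  have hnn : 0 ≤ᵐ[bMeasure] fun θ => M - Real.log ‖bdry g θ‖ := by
    filter_upwards [hbd, hne] with θ h h1
    exact sub_nonneg.2 (Real.log_le_log (norm_pos_iff.2 h1) (by linarith))
  have hI : Integrable (fun θ => M - Real.log ‖bdry g θ‖) bMeasure :=
    ⟨(hlogm.const_sub M).aestronglyMeasurable, (hasFiniteIntegral_iff_ofReal hnn).2
      (hfatou.trans_lt ENNReal.ofReal_lt_top)⟩
  have hI' : Integrable (fun θ => Real.log ‖bdry g θ‖) bMeasure := by
    refine ((integrable_const M).sub hI).congr (ae_of_all _ fun θ => ?_)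
    simp
  refine ⟨hne, hI', ?_⟩
  have h2 : ∫ θ, (M - Real.log ‖bdry g θ‖) ∂bMeasure ≤ K := by
    rw [integral_eq_lintegral_of_nonneg_ae hnn hI.aestronglyMeasurable]
    exact ENNReal.toReal_le_of_le_ofReal hK hfatou
  rw [integral_sub (integrable_const _) hI', integral_const, bMeasure_real_univ, smul_eq_mul] at h2
  linarith

theorem IsOuter.log_norm_zero {v : ℂ → ℂ} (hv : IsOuter v) :
    2 * Real.pi * Real.log ‖v 0‖ = ∫ θ, Real.log ‖bdry v θ‖ ∂bMeasure := by
  obtain ⟨-, c, hc, h⟩ := hv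
  have h1 : ∀ θ, (uc θ + 0) / (uc θ - 0) = 1 := fun θ => by simp [uc_ne_zero]
  rw [h 0 (by simp [unitDisk]), norm_mul, hc, one_mul, Complex.norm_exp, Real.log_exp]
  simp only [h1, one_mul]
  rw [intervalIntegral_eq_bMeasure, integral_complex_ofReal]
  have h2 : (1 / (2 * (Real.pi : ℂ))) = ((1 / (2 * Real.pi) : ℝ) : ℂ) := by push_cast; rfl
  rw [h2, ← Complex.ofReal_mul, Complex.ofReal_re]
  field_simp

theorem integral_mul_bdry_eq {W : ℝ → ℂ} (hWm : AEStronglyMeasurable W bMeasure)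
    (hW : ∀ᵐ θ ∂bMeasure, ‖W θ‖ = 1)
    (hker : ∀ w : ℂ, ‖w‖ < 1 → ∫ θ, W θ * (uc θ * (1 - w * uc θ)⁻¹) ∂bMeasure = 0)
    {u : ℂ → ℂ} (hu : MemHinf u) :
    ∫ θ, W θ * bdry u θ ∂bMeasure = u 0 * ∫ θ, W θ ∂bMeasure := by
  obtain ⟨C, hC⟩ := hu.2
  have hWi : Integrable W bMeasure := Integrable.of_bound hWm 1 (hW.mono fun _ h => h.le)
  have hpi : (2 * Real.pi : ℂ) ≠ 0 := by simp [Real.pi_ne_zero]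
  have hkc : ∀ w : ℂ, ‖w‖ < 1 → Continuous fun θ => (1 - w * uc θ)⁻¹ := fun w hw =>
    (continuous_const.sub (continuous_const.mul continuous_uc)).inv₀
      fun θ => one_sub_mul_ne_zero hw (norm_uc θ).le
  have hker' : ∀ w : ℂ, ‖w‖ < 1 →
      ∫ θ, W θ * (1 - w * uc θ)⁻¹ ∂bMeasure = ∫ θ, W θ ∂bMeasure := by
    intro w hw
    obtain ⟨D, hD⟩ := (memHinf_cauchyKernel hw).2
    have hb : ∀ᵐ θ ∂bMeasure, ‖(1 - w * uc θ)⁻¹‖ ≤ D := by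
      filter_upwards [norm_bdry_le (memHinf_cauchyKernel hw) hD] with θ h
      rwa [bdry_cauchyKernel hw] at h
    have h1 : Integrable (fun θ => W θ * (uc θ * (1 - w * uc θ)⁻¹)) bMeasure := by
      refine hWi.mul_bdd (c := D) (continuous_uc.mul (hkc w hw)).aestronglyMeasurable ?_
      filter_upwards [hb] with θ h
      rwa [norm_mul, norm_uc, one_mul]
    have h2 : ∀ θ, W θ * (1 - w * uc θ)⁻¹ = W θ + w * (W θ * (uc θ * (1 - w * uc θ)⁻¹)) := by
      intro θ
      have := one_sub_mul_ne_zero hw (norm_uc θ).le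
      field_simp
      ring
    simp only [h2]
    rw [integral_add hWi (h1.const_mul w), integral_const_mul, hker w hw, mul_zero, add_zero]
  have hev : ∀ᶠ r : ℝ in nhdsWithin 1 (Iio 1), r ∈ Ioo 0 1 := Ioo_mem_nhdsLT one_pos
  have hlim : Tendsto (fun r : ℝ => ∫ θ, W θ * u (r * uc θ) ∂bMeasure) (nhdsWithin 1 (Iio 1))
      (nhds (∫ θ, W θ * bdry u θ ∂bMeasure)) := by
    refine tendsto_integral_filter_of_dominated_convergence (fun _ => C) ?_ ?_
      (integrable_const _) ?_
    · filter_upwards [hev] with r hr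
      exact hWm.mul (continuous_comp_mul_uc hu.1
        (mul_uc_mem_unitDisk hr.1.le hr.2)).aestronglyMeasurable
    · filter_upwards [hev] with r hr
      filter_upwards [hW] with θ h
      rw [norm_mul, h, one_mul]
      exact hC _ (mul_uc_mem_unitDisk hr.1.le hr.2 θ)
    · filter_upwards [ae_bMeasure_of_ae (ae_tendsto_bdry hu)] with θ h
      exact h.const_mul _
  refine tendsto_nhds_unique (hlim.congr' ?_) tendsto_const_nhds
  filter_upwards [hev] with r hr
  set w : ℝ → ℂ := fun φ => r * (uc φ)⁻¹ with hwdef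
  have hw : ∀ φ, ‖w φ‖ = r := fun φ => by
    rw [hwdef, norm_mul, norm_inv, norm_uc, Complex.norm_real, Real.norm_of_nonneg hr.1.le]
    simp
  have hw1 : ∀ φ, ‖w φ‖ < 1 := fun φ => (hw φ).trans_lt hr.2
  have hwc : Continuous w := continuous_const.mul (continuous_uc.inv₀ uc_ne_zero)
  have hcauchy : ∀ θ, u (r * uc θ) =
      (2 * Real.pi : ℂ)⁻¹ * ∫ φ, (1 - w φ * uc θ)⁻¹ * bdry u φ ∂bMeasure := by
    intro θ
    rw [eq_inv_mul_iff_mul_eq₀ hpi,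
      ← integral_cauchy_bdry hu (mul_uc_mem_unitDisk hr.1.le hr.2 θ)]
    congr 1
    funext φ
    have h1 : uc φ - r * uc θ = uc φ * (1 - w φ * uc θ) := by
      rw [hwdef]
      have := uc_ne_zero φ
      field_simp
    rw [h1, div_mul_cancel_left₀ (uc_ne_zero φ)]
  have hint : Integrable (Function.uncurry fun θ φ => W θ * ((1 - w φ * uc θ)⁻¹ * bdry u φ))
      (bMeasure.prod bMeasure) := by
    refine ((hWi.mul_prod (integrable_bdry hu)).mul_bdd (c := (1 - r)⁻¹)
      (g := fun p : ℝ × ℝ => (1 - w p.2 * uc p.1)⁻¹) ?_ ?_).congr ?_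
    · refine Continuous.aestronglyMeasurable (Continuous.inv₀ (continuous_const.sub
        ((hwc.comp continuous_snd).mul (continuous_uc.comp continuous_fst))) fun p => ?_)
      exact one_sub_mul_ne_zero (hw1 p.2) (norm_uc p.1).le
    · refine Eventually.of_forall fun p => ?_
      rw [norm_inv]
      refine inv_anti₀ (by linarith [hr.2]) ?_
      have := norm_sub_norm_le (1 : ℂ) (w p.2 * uc p.1)
      rwa [norm_one, norm_mul, hw, norm_uc, mul_one] at this
    · refine Eventually.of_forall fun p => ?_
      simp only [Function.uncurry]
      ring
  calc ∫ θ, W θ * u (r * uc θ) ∂bMeasure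
      = (2 * Real.pi : ℂ)⁻¹ *
          ∫ θ, ∫ φ, W θ * ((1 - w φ * uc θ)⁻¹ * bdry u φ) ∂bMeasure ∂bMeasure := by
        rw [← integral_const_mul]
        congr 1
        funext θ
        rw [hcauchy, integral_const_mul]
        ring
    _ = (2 * Real.pi : ℂ)⁻¹ *
          ∫ φ, ∫ θ, W θ * ((1 - w φ * uc θ)⁻¹ * bdry u φ) ∂bMeasure ∂bMeasure := by
        rw [integral_integral_swap hint]
    _ = (2 * Real.pi : ℂ)⁻¹ * ∫ φ, (∫ θ, W θ ∂bMeasure) * bdry u φ ∂bMeasure := by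
        congr 2
        funext φ
        rw [← hker' (w φ) (hw1 φ), ← integral_mul_const]
        simp only [mul_assoc]
    _ = u 0 * ∫ θ, W θ ∂bMeasure := by
        rw [integral_const_mul, integral_bdry hu]
        field_simp

theorem ae_eq_const_of_bdry_eq_mul {W : ℝ → ℂ} (hWm : AEStronglyMeasurable W bMeasure)
    (hW : ∀ᵐ θ ∂bMeasure, ‖W θ‖ = 1)
    (hker : ∀ w : ℂ, ‖w‖ < 1 → ∫ θ, W θ * (uc θ * (1 - w * uc θ)⁻¹) ∂bMeasure = 0)
    {u v : ℂ → ℂ} (hu : MemHinf u) (hv : MemHinf v) (hvo : IsOuter v)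
    (huv : ∀ᵐ θ ∂bMeasure, bdry v θ = W θ * bdry u θ) :
    ∃ c : ℂ, ‖c‖ = 1 ∧ ∀ᵐ θ ∂bMeasure, W θ = c := by
  have hv0 : v 0 ≠ 0 := hvo.ne_zero (by simp [unitDisk])
  have hmean : 2 * Real.pi * v 0 = u 0 * ∫ θ, W θ ∂bMeasure := by
    rw [← integral_bdry hv, integral_congr_ae huv, integral_mul_bdry_eq hWm hW hker hu]
  have hu0 : u 0 ≠ 0 := by
    intro h
    rw [h, zero_mul] at hmean
    simp [Real.pi_ne_zero, hv0] at hmean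
  have hlog : Real.log ‖u 0‖ ≤ Real.log ‖v 0‖ := by
    have h1 := (integrable_log_norm_bdry hu hu0).2.2
    have h2 : ∫ θ, Real.log ‖bdry u θ‖ ∂bMeasure = ∫ θ, Real.log ‖bdry v θ‖ ∂bMeasure := by
      refine integral_congr_ae ?_
      filter_upwards [hW, huv] with θ h3 h4
      rw [h4, norm_mul, h3, one_mul]
    rw [h2, ← hvo.log_norm_zero] at h1
    exact le_of_mul_le_mul_left h1 (by positivity)
  have hle : ‖u 0‖ ≤ ‖v 0‖ :=
    (Real.log_le_log_iff (norm_pos_iff.2 hu0) (norm_pos_iff.2 hv0)).1 hlog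
  have hlarge : ¬ ‖∫ θ, W θ ∂bMeasure‖ < bMeasure.real univ * 1 := by
    rw [bMeasure_real_univ, mul_one, not_lt]
    have h1 := congrArg norm hmean
    rw [norm_mul, norm_mul, norm_mul, Complex.norm_two, Complex.norm_real,
      Real.norm_of_nonneg Real.pi_pos.le] at h1
    have h2 : 0 < ‖u 0‖ := norm_pos_iff.2 hu0
    refine le_of_mul_le_mul_left ?_ h2
    rw [← h1, mul_comm]
    exact mul_le_mul_of_nonneg_left hle (by positivity)
  have hc := (ae_eq_const_or_norm_integral_lt_of_norm_le_const (f := W)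
    (hW.mono fun _ h => h.le)).resolve_right hlarge
  have hne : (ae bMeasure).NeBot := by
    rw [ae_neBot]
    intro h
    have := bMeasure_real_univ
    rw [h] at this
    simp [Real.pi_ne_zero] at this
  obtain ⟨θ, h1, h2⟩ := (hW.and hc).exists
  refine ⟨⨍ θ, W θ ∂bMeasure, ?_, hc⟩
  rw [← h1, h2]
  rfl

theorem modelSpace_eq_of_bdry_eq {I I₀ : ℂ → ℂ} {c : ℂ} (hc : c ≠ 0)
    (h : ∀ᵐ θ ∂bMeasure, bdry I θ = c * bdry I₀ θ) : modelSpace I = modelSpace I₀ := by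
  have key : ∀ k z, toeplitz (conjBdry I) k z =
      (starRingEnd ℂ) c * toeplitz (conjBdry I₀) k z := by
    intro k z
    simp only [toeplitz, szProj, intervalIntegral_eq_bMeasure]
    rw [mul_left_comm ((starRingEnd ℂ) c), ← integral_const_mul ((starRingEnd ℂ) c)]
    congr 1
    refine integral_congr_ae ?_
    filter_upwards [h] with θ hθ
    simp only [conjBdry, hθ, map_mul]
    ring
  simp [modelSpace, toeplitzKer, key, hc]

/-- Let `f` be outer in `H²` and `I, I₀` inner with
`I(0) = I₀(0) = 0`.  If `f·K_I = f·K_{I₀}(|f|²)`, then `K_I = K_{I₀}`, and hence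
`I = I₀` up to a unimodular constant factor. -/
theorem weighted_model_identification (f I I₀ : ℂ → ℂ)
    (hf : IsOuter f) (hf2 : MemH2 f)
    (hI : IsInner I) (hI0 : I 0 = 0)
    (hI₀ : IsInner I₀) (hI₀0 : I₀ 0 = 0)
    (heq : fModel f I =
      {g : ℂ → ℂ | ∃ h ∈ weightedModel f I₀, ∀ z ∈ unitDisk, g z = f z * h z}) :
    modelSpace I = modelSpace I₀ ∧
      ∃ c : ℂ, ‖c‖ = 1 ∧ ∀ z ∈ unitDisk, I z = c * I₀ z := by
  have hK := modelSpace_eq_weightedModel hf heq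
  have hone : MemWeightedH2 f fun _ => 1 := (hK ▸ one_mem_modelSpace hI.memHinf hI0 :
    (fun _ => 1) ∈ weightedModel f I₀).1
  obtain ⟨J₀, hJ₀, hIJ₀⟩ := hI₀.exists_eq_mul hI₀0
  obtain ⟨J, hJ, hIJ⟩ := hI.exists_eq_mul hI0
  have hJ₀K : J₀ ∈ modelSpace I := hK ▸ hI₀.mem_weightedModel hJ₀ hIJ₀ hone
  have hJK : J ∈ weightedModel f I₀ := hK ▸ hI.mem_modelSpace hJ hIJ
  set W : ℝ → ℂ := fun θ => bdry I θ * (starRingEnd ℂ) (bdry I₀ θ)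
  have hWm : AEStronglyMeasurable W bMeasure :=
    (aestronglyMeasurable_bdry hI.memHinf).mul
      (Complex.continuous_conj.comp_aestronglyMeasurable (aestronglyMeasurable_bdry hI₀.memHinf))
  have hW : ∀ᵐ θ ∂bMeasure, ‖W θ‖ = 1 := by
    filter_upwards [hI.2.2, hI₀.2.2] with θ h1 h2
    rw [norm_mul, RCLike.norm_conj, h1, h2, one_mul]
  have hker : ∀ w : ℂ, ‖w‖ < 1 → ∫ θ, W θ * (uc θ * (1 - w * uc θ)⁻¹) ∂bMeasure = 0 := by
    intro w hw
    have h1 := hJ₀K.2 ((starRingEnd ℂ) w) (mem_unitDisk.2 (by rwa [RCLike.norm_conj]))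
    rw [toeplitz, szProj, intervalIntegral_eq_bMeasure] at h1
    have h2 := (mul_eq_zero.1 h1).resolve_left (by simp [Real.pi_ne_zero])
    rw [← map_eq_zero (starRingEnd ℂ), ← integral_conj] at h2
    rw [← h2]
    refine integral_congr_ae ?_
    filter_upwards [hIJ₀] with θ h3
    rw [conjBdry, h3]
    simp only [map_mul, map_inv₀, map_sub, map_one, Complex.conj_conj, conj_uc, inv_inv]
    ring
  obtain ⟨-, ψ, ⟨q, ⟨⟨u, v, hu, hv, hvo, hq⟩, -⟩, hψ⟩, hJψ⟩ := hJK
  have huv : ∀ᵐ θ ∂bMeasure, bdry v θ = W θ * bdry u θ := by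
    filter_upwards [(integrable_log_norm_bdry hv (hvo.ne_zero (by simp [unitDisk]))).1,
      ae_bMeasure_of_ae (ae_tendsto_bdry hu), ae_bMeasure_of_ae (ae_tendsto_bdry hv),
      hIJ, hJψ, hI.2.2] with θ hv0 hut hvt h1 h2 h3
    have h4 : bdry ψ θ = uc θ * (bdry u θ / bdry v θ) := by
      rw [bdry_congr (k := fun z => z * (u z / v z)) fun z hz => by rw [hψ z hz, hq z hz]]
      exact bdry_eq_of_tendsto ((tendsto_mul_uc θ).mul (hut.div hvt hv0))
    have h5 : bdry I θ * (starRingEnd ℂ) (bdry I θ) = 1 := by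
      rw [Complex.mul_conj, Complex.normSq_eq_norm_sq, h3]; simp
    have h6 : (starRingEnd ℂ) (bdry I θ) =
        (starRingEnd ℂ) (bdry I₀ θ) * (bdry u θ / bdry v θ) := by
      rw [h1, h4] at h2
      have h7 := congrArg (starRingEnd ℂ) h2
      simp only [map_mul, map_inv₀, Complex.conj_conj, conj_uc, inv_inv] at h7
      refine mul_right_cancel₀ (uc_ne_zero θ) (h7.trans (by ring))
    rw [h6] at h5
    field_simp at h5
    rw [← h5]
  obtain ⟨c, hc, hWc⟩ := ae_eq_const_of_bdry_eq_mul hWm hW hker hu hv hvo huv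
  have hII₀ : ∀ᵐ θ ∂bMeasure, bdry I θ = c * bdry I₀ θ := by
    filter_upwards [hWc, hI₀.2.2] with θ h1 h2
    rw [← h1, mul_assoc, ← Complex.normSq_eq_conj_mul_self, Complex.normSq_eq_norm_sq, h2]
    simp
  refine ⟨modelSpace_eq_of_bdry_eq (norm_pos_iff.1 (hc ▸ one_pos)) hII₀, c, hc,
    fun z hz => ?_⟩
  refine eq_of_bdry_ae_eq hI.memHinf ((memHinf_const c).mul hI₀.memHinf) ?_ hz
  filter_upwards [hII₀, bdry_const_mul hI₀.memHinf c] with θ h1 h2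
  rw [h1, h2]

end
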